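/- Let n ≥ 2 and n < p < +∞. There exists a constant C > 0, depending only on n and p, such that every u ∈ C_c^∞(ℝⁿ₊) satisfies, for all x, y ∈ ℝⁿ₊, |u(x) − u(y)| ≤ C · min( d_ℍ(x,y)^{1 − n/p}, 1 ) · ( ∫_{ℝⁿ₊} ‖Du(z)‖^p zₙ^{p−n} dz )^{1/p}. -/

import Mathlib

open MeasureTheory Real Set
open scoped ENNReal

noncomputable section

/-- The last coordinate `xₙ` of a point of `ℝⁿ`. -/
def lastCoord (n : ℕ) (x : EuclideanSpace ℝ (Fin n)) : ℝ :=
  if h : 0 < n then x ⟨n - 1, Nat.sub_lt h one_pos⟩ else 0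

/-- The open upper half-space `ℝⁿ₊`. -/
def upperHalf (n : ℕ) : Set (EuclideanSpace ℝ (Fin n)) :=
  {z | 0 < lastCoord n z}

/-- The weighted energy `E_γ(u) = ∫_{ℝⁿ₊} ‖Du(z)‖^p zₙ^γ dz`, as a value in `[0, +∞]`. -/
def energy (n : ℕ) (γ p : ℝ) (u : EuclideanSpace ℝ (Fin n) → ℝ) : ℝ≥0∞ :=
  ∫⁻ z in upperHalf n, ENNReal.ofReal (‖fderiv ℝ u z‖ ^ p * lastCoord n z ^ γ)

/-- The hyperbolic distance on the Poincaré half-space model. -/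
def hypDist (n : ℕ) (x y : EuclideanSpace ℝ (Fin n)) : ℝ :=
  2 * Real.arsinh (‖x - y‖ / (2 * Real.sqrt (lastCoord n x * lastCoord n y)))

section
variable {E : Type*} [NormedAddCommGroup E] [NormedSpace ℝ E]

lemma enorm_sub_le_lintegral_fderiv {u : E → ℝ} (hu : ContDiff ℝ 1 u) (x w : E) :
    ‖u w - u x‖ₑ ≤
      ∫⁻ t in Ioc (0 : ℝ) 1, ‖fderiv ℝ u (x + t • (w - x))‖ₑ * ‖w - x‖ₑ := by
  have hd (t : ℝ) : HasDerivAt (fun t : ℝ => u (x + t • (w - x)))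
      (fderiv ℝ u (x + t • (w - x)) (w - x)) t := by
    have h1 : HasDerivAt (fun t : ℝ => x + t • (w - x)) (w - x) t := by
      simpa using ((hasDerivAt_id t).smul_const (w - x)).const_add x
    exact ((hu.differentiable one_ne_zero) _).hasFDerivAt.comp_hasDerivAt t h1
  have hc : Continuous fun t : ℝ => fderiv ℝ u (x + t • (w - x)) (w - x) := by
    have := hu.continuous_fderiv one_ne_zero
    fun_prop
  have h := intervalIntegral.integral_eq_sub_of_hasDerivAt (fun t _ => hd t)
    (hc.intervalIntegrable 0 1)
  rw [intervalIntegral.integral_of_le zero_le_one] at h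
  simp only [one_smul, zero_smul, add_zero, add_sub_cancel] at h
  rw [← h]
  exact (enorm_integral_le_lintegral_enorm _).trans
    (lintegral_mono fun t => ContinuousLinearMap.le_opENorm _ _)

variable [MeasurableSpace E] [BorelSpace E] [FiniteDimensional ℝ E]
  (μ : Measure E) [μ.IsAddHaarMeasure]

lemma lintegral_comp_homothety {f : E → ℝ≥0∞} (hf : Measurable f) (x : E) {t : ℝ} (ht : 0 < t) :
    ∫⁻ w, f (x + t • (w - x)) ∂μ =
      ENNReal.ofReal (t ^ (-(Module.finrank ℝ E : ℝ))) * ∫⁻ z, f z ∂μ := by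
  have h1 : ∫⁻ w, f (x + t • (w - x)) ∂μ = ∫⁻ w, f (x + t • w) ∂μ :=
    lintegral_sub_right_eq_self (fun w => f (x + t • w)) x
  have h2 : ∫⁻ w, f (x + t • w) ∂μ = ∫⁻ z, f (x + z) ∂(Measure.map (t • ·) μ) :=
    (lintegral_map (f := fun z => f (x + z)) (hf.comp (measurable_const_add x))
      (measurable_const_smul t)).symm
  rw [h1, h2, Measure.map_addHaar_smul μ ht.ne', lintegral_smul_measure, smul_eq_mul,
    lintegral_add_left_eq_self, rpow_neg ht.le, rpow_natCast, abs_of_pos (by positivity)]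

/-- Average oscillation of `u` over a set, by Hölder's inequality with a weight on every
homothetic image of the set. -/
lemma setLIntegral_enorm_sub_le {u : E → ℝ} (hu : ContDiff ℝ 1 u) {p q : ℝ}
    (hpq : p.HolderConjugate q) (hp : (Module.finrank ℝ E : ℝ) < p) {F η : E → ℝ≥0∞}
    (hF : Measurable F) (hη : Measurable η) (hFη : ∀ z, ‖fderiv ℝ u z‖ₑ ≤ F z * η z)
    {x : E} {D : Set E} (hD : MeasurableSet D) {ρ : ℝ} (hDρ : D ⊆ Metric.closedBall x ρ)
    {K : ℝ≥0∞} (hK : ∀ t ∈ Ioc (0 : ℝ) 1, ∫⁻ w in D, η (x + t • (w - x)) ^ q ∂μ ≤ K) :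
    ∫⁻ w in D, ‖u w - u x‖ₑ ∂μ ≤
      ENNReal.ofReal ρ * ENNReal.ofReal (1 / (1 - (Module.finrank ℝ E : ℝ) / p)) *
        K ^ (1 / q) * (∫⁻ z, F z ^ p ∂μ) ^ (1 / p) := by
  set d : ℝ := (Module.finrank ℝ E : ℝ) with hd
  have hp0 : 0 < p := hpq.pos
  have hdp : d / p < 1 := (div_lt_one hp0).2 hp
  have hc := hu.continuous_fderiv one_ne_zero
  have hinner : ∀ t ∈ Ioc (0 : ℝ) 1,
      ∫⁻ w in D, ‖fderiv ℝ u (x + t • (w - x))‖ₑ * ‖w - x‖ₑ ∂μ ≤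
        ENNReal.ofReal ρ * K ^ (1 / q) * (∫⁻ z, F z ^ p ∂μ) ^ (1 / p) *
          ENNReal.ofReal (t ^ (-(d / p))) := by
    intro t ht
    calc ∫⁻ w in D, ‖fderiv ℝ u (x + t • (w - x))‖ₑ * ‖w - x‖ₑ ∂μ
        ≤ ∫⁻ w in D, (F (x + t • (w - x)) * η (x + t • (w - x))) * ENNReal.ofReal ρ ∂μ := by
          refine setLIntegral_mono' hD fun w hw => ?_
          refine mul_le_mul' (hFη _) ?_
          rw [← ofReal_norm, ← dist_eq_norm]
          exact ENNReal.ofReal_le_ofReal (hDρ hw)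
      _ = (∫⁻ w in D, F (x + t • (w - x)) * η (x + t • (w - x)) ∂μ) * ENNReal.ofReal ρ := by
          rw [lintegral_mul_const' _ _ ENNReal.ofReal_ne_top]
      _ ≤ ((∫⁻ w in D, F (x + t • (w - x)) ^ p ∂μ) ^ (1 / p) *
            (∫⁻ w in D, η (x + t • (w - x)) ^ q ∂μ) ^ (1 / q)) * ENNReal.ofReal ρ := by
          gcongr
          exact ENNReal.lintegral_mul_le_Lp_mul_Lq _ hpq
            (hF.comp (by fun_prop)).aemeasurable (hη.comp (by fun_prop)).aemeasurable
      _ ≤ ((ENNReal.ofReal (t ^ (-d)) * ∫⁻ z, F z ^ p ∂μ) ^ (1 / p) * K ^ (1 / q)) *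
            ENNReal.ofReal ρ := by
          have hq0 : 0 ≤ 1 / q := by have := hpq.symm.pos; positivity
          gcongr
          · rw [← lintegral_comp_homothety μ (f := fun z => F z ^ p) (hF.pow_const p) x ht.1]
            exact setLIntegral_le_lintegral _ _
          · exact hK t ht
      _ = _ := by
          rw [ENNReal.mul_rpow_of_nonneg _ _ (by positivity),
            ENNReal.ofReal_rpow_of_pos (rpow_pos_of_pos ht.1 _), ← rpow_mul ht.1.le]
          rw [show -d * (1 / p) = -(d / p) by ring]
          ring
  have htime : ∫⁻ t in Ioc (0 : ℝ) 1, ENNReal.ofReal (t ^ (-(d / p))) =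
      ENNReal.ofReal (1 / (1 - d / p)) := by
    have hi := intervalIntegral.intervalIntegrable_rpow' (r := -(d / p)) (by linarith)
      (a := 0) (b := 1)
    rw [← ofReal_integral_eq_lintegral_ofReal hi.1
      ((ae_restrict_mem measurableSet_Ioc).mono fun t ht => rpow_nonneg ht.1.le _),
      ← intervalIntegral.integral_of_le zero_le_one, integral_rpow (Or.inl (by linarith))]
    rw [one_rpow, zero_rpow (by linarith)]
    congr 2 <;> ring
  calc ∫⁻ w in D, ‖u w - u x‖ₑ ∂μ
      ≤ ∫⁻ w in D, (∫⁻ t in Ioc (0 : ℝ) 1,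
          ‖fderiv ℝ u (x + t • (w - x))‖ₑ * ‖w - x‖ₑ) ∂μ :=
        lintegral_mono fun w => enorm_sub_le_lintegral_fderiv hu x w
    _ = ∫⁻ t in Ioc (0 : ℝ) 1, ∫⁻ w in D,
          ‖fderiv ℝ u (x + t • (w - x))‖ₑ * ‖w - x‖ₑ ∂μ := by
        have h1 : Continuous fun z : E × ℝ => fderiv ℝ u (x + z.2 • (z.1 - x)) := by fun_prop
        have h2 : Continuous fun z : E × ℝ => z.1 - x := by fun_prop
        exact lintegral_lintegral_swap
          (h1.enorm.measurable.mul h2.enorm.measurable).aemeasurable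
    _ ≤ ∫⁻ t in Ioc (0 : ℝ) 1, ENNReal.ofReal ρ * K ^ (1 / q) *
          (∫⁻ z, F z ^ p ∂μ) ^ (1 / p) * ENNReal.ofReal (t ^ (-(d / p))) :=
        setLIntegral_mono' measurableSet_Ioc hinner
    _ = _ := by
        rw [lintegral_const_mul _ (by fun_prop), htime]
        ring

end

lemma setLIntegral_comp_eval_pi {ι : Type*} [Fintype ι] [DecidableEq ι] (I : ι → Set ℝ) (i : ι)
    {φ : ℝ → ℝ≥0∞} (hφ : Measurable φ) :
    ∫⁻ z in Set.univ.pi I, φ (z i) =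
      (∏ j ∈ Finset.univ.erase i, volume (I j)) * ∫⁻ s in I i, φ s := by
  rw [volume_pi, Measure.restrict_pi_pi]
  have h := lintegral_map (μ := Measure.pi fun j => volume.restrict (I j)) hφ
    (measurable_pi_apply i)
  rw [← h]
  have := Measure.pi_map_eval (fun j => (volume : Measure ℝ).restrict (I j)) i
  unfold Function.eval at this
  rw [this, lintegral_smul_measure]
  simp

lemma one_half_rpow_neg_le {a : ℝ} (ha : a ≤ 1) : (1 / 2 : ℝ) ^ (-a) ≤ 2 := by
  rw [one_div, inv_rpow two_pos.le, ← rpow_neg two_pos.le, neg_neg]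
  exact (rpow_le_rpow_of_exponent_le one_le_two ha).trans_eq (rpow_one 2)

lemma setLIntegral_abs_rpow_neg_le {a h t : ℝ} (ha0 : 0 ≤ a) (ha : a < 1) (hh : 0 < h)
    (ht : t ∈ Ioc (0 : ℝ) 1) :
    ∫⁻ s in Icc (-h) 0, ENNReal.ofReal (|h + t * (s - h)| ^ (-a)) ≤
      ENNReal.ofReal (8 / (1 - a) * h ^ (-a)) * ENNReal.ofReal h := by
  have hvol : (volume (Icc (-h) (0 : ℝ))) = ENNReal.ofReal h := by simp
  have h2a : (1 / 2 : ℝ) ^ (-a) ≤ 2 := one_half_rpow_neg_le ha.le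
  rcases le_or_gt t (1 / 4) with h4 | h4
  · rw [← hvol, ← setLIntegral_const]
    refine setLIntegral_mono' measurableSet_Icc fun s hs => ENNReal.ofReal_le_ofReal ?_
    have hge : h * (1 / 2) ≤ h + t * (s - h) := by nlinarith [hs.1, ht.1]
    rw [abs_of_pos (by linarith)]
    calc (h + t * (s - h)) ^ (-a) ≤ (h * (1 / 2)) ^ (-a) :=
          rpow_le_rpow_of_nonpos (by linarith) hge (by linarith)
      _ = (1 / 2 : ℝ) ^ (-a) * h ^ (-a) := by rw [mul_rpow hh.le (by norm_num)]; ring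
      _ ≤ 8 / (1 - a) * h ^ (-a) := by
          gcongr
          refine h2a.trans ?_
          rw [le_div_iff₀ (by linarith)]
          linarith
  · set g : ℝ → ℝ≥0∞ := (Icc (-h) h).indicator fun y => ENNReal.ofReal (|y| ^ (-a)) with hg
    have hgm : Measurable g := Measurable.indicator (by fun_prop) measurableSet_Icc
    have hpos : ∫⁻ y in Icc 0 h, ENNReal.ofReal (|y| ^ (-a)) =
        ENNReal.ofReal (h ^ (1 - a) / (1 - a)) := by
      have hi := intervalIntegral.intervalIntegrable_rpow' (r := -a) (by linarith)
        (a := 0) (b := h)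
      rw [setLIntegral_congr Ioc_ae_eq_Icc.symm, setLIntegral_congr_fun measurableSet_Ioc
        (g := fun y => ENNReal.ofReal (y ^ (-a))) (fun y hy => by simp only [abs_of_pos hy.1])]
      rw [← ofReal_integral_eq_lintegral_ofReal ((intervalIntegrable_iff_integrableOn_Ioc_of_le
          hh.le).1 hi)
        ((ae_restrict_mem measurableSet_Ioc).mono fun t ht => rpow_nonneg ht.1.le _),
        ← intervalIntegral.integral_of_le hh.le, integral_rpow (Or.inl (by linarith))]
      rw [zero_rpow (by linarith), sub_zero, neg_add_eq_sub]
    have hneg : ∫⁻ y in Icc (-h) 0, ENNReal.ofReal (|y| ^ (-a)) =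
        ENNReal.ofReal (h ^ (1 - a) / (1 - a)) := by
      rw [← hpos, ← (Measure.measurePreserving_neg volume).setLIntegral_comp_preimage_emb
        (MeasurableEquiv.neg ℝ).measurableEmbedding _ (Icc (-h) 0)]
      simp
    have hgint : ∫⁻ y, g y ≤ ENNReal.ofReal (2 * (h ^ (1 - a) / (1 - a))) := by
      rw [hg, lintegral_indicator measurableSet_Icc, ← Icc_union_Icc_eq_Icc (by linarith) hh.le]
      refine (lintegral_union_le _ _ _).trans ?_
      rw [hpos, hneg, two_mul, ENNReal.ofReal_add] <;>
      exact div_nonneg (by positivity) (by linarith)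
    calc ∫⁻ s in Icc (-h) 0, ENNReal.ofReal (|h + t * (s - h)| ^ (-a))
        ≤ ∫⁻ s in Icc (-h) 0, g (h + t • (s - h)) := by
          refine setLIntegral_mono' measurableSet_Icc fun s hs => ?_
          rw [hg, indicator_of_mem, smul_eq_mul]
          constructor <;> rw [smul_eq_mul] <;> nlinarith [hs.1, hs.2, ht.1, ht.2]
      _ ≤ ∫⁻ s, g (h + t • (s - h)) := setLIntegral_le_lintegral _ _
      _ = ENNReal.ofReal (t ^ (-(1 : ℝ))) * ∫⁻ y, g y := by
          simpa using lintegral_comp_homothety volume hgm h ht.1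
      _ ≤ ENNReal.ofReal 4 * ENNReal.ofReal (2 * (h ^ (1 - a) / (1 - a))) := by
          gcongr
          rw [rpow_neg_one]
          exact inv_le_of_inv_le₀ (by norm_num) (by linarith)
      _ = _ := by
          have : 0 < 1 - a := by linarith
          rw [← ENNReal.ofReal_mul (by norm_num), ← ENNReal.ofReal_mul (by positivity),
            sub_eq_add_neg 1 a, rpow_add hh, rpow_one]
          congr 1
          ring

lemma continuous_lastCoord (n : ℕ) : Continuous (lastCoord n) := by
  unfold lastCoord
  split_ifs <;> fun_prop

lemma lastCoord_homothety (n : ℕ) (x w : EuclideanSpace ℝ (Fin n)) (t : ℝ) :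
    lastCoord n (x + t • (w - x)) = lastCoord n x + t * (lastCoord n w - lastCoord n x) := by
  unfold lastCoord
  split_ifs <;> simp

lemma abs_lastCoord_sub_le (n : ℕ) (x y : EuclideanSpace ℝ (Fin n)) :
    |lastCoord n x - lastCoord n y| ≤ ‖x - y‖ := by
  unfold lastCoord
  split_ifs with h
  · simpa using PiLp.norm_apply_le (x - y) ⟨n - 1, Nat.sub_lt h one_pos⟩
  · simp

lemma measurableSet_upperHalf (n : ℕ) : MeasurableSet (upperHalf n) :=
  (isOpen_lt continuous_const (continuous_lastCoord n)).measurableSet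

lemma energy_ne_top {n : ℕ} {γ p : ℝ} (hγ : 0 ≤ γ) (hp : 0 < p)
    {u : EuclideanSpace ℝ (Fin n) → ℝ} (hu : ContDiff ℝ 1 u) (hc : HasCompactSupport u) :
    energy n γ p u ≠ ⊤ := by
  have hcd := hu.continuous_fderiv one_ne_zero
  have hcont : Continuous fun z => ‖fderiv ℝ u z‖ ^ p * |lastCoord n z| ^ γ :=
    (hcd.norm.rpow_const fun _ => Or.inr hp.le).mul
      ((continuous_lastCoord n).abs.rpow_const fun _ => Or.inr hγ)
  have hsupp : HasCompactSupport fun z => ‖fderiv ℝ u z‖ ^ p * |lastCoord n z| ^ γ :=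
    (hc.fderiv ℝ).mono fun z hz h0 => hz (by simp [h0, zero_rpow hp.ne'])
  have hint := (hcont.integrable_of_hasCompactSupport (μ := volume) hsupp).lintegral_lt_top
  refine ne_top_of_le_ne_top hint.ne ?_
  refine le_trans (le_of_eq ?_) (setLIntegral_le_lintegral (upperHalf n) _)
  refine setLIntegral_congr_fun (measurableSet_upperHalf n) fun z hz => ?_
  simp only [abs_of_pos (show 0 < lastCoord n z from hz)]

lemma le_of_ofReal_mul_le_ofReal_mul {V : ℝ≥0∞} (hV0 : V ≠ 0) (hV : V ≠ ⊤) {a b : ℝ} (hb : 0 ≤ b)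
    (h : ENNReal.ofReal a * V ≤ ENNReal.ofReal b * V) : a ≤ b :=
  (ENNReal.ofReal_le_ofReal_iff hb).1 ((ENNReal.mul_le_mul_iff_left hV0 hV).1 h)

lemma setLIntegral_enorm_sub_le_energy {n : ℕ} (hn : 1 < n) {p : ℝ} (hnp : (n : ℝ) < p)
    {u : EuclideanSpace ℝ (Fin n) → ℝ} (hu : ContDiff ℝ 1 u) (hc : HasCompactSupport u)
    (hsupp : tsupport u ⊆ upperHalf n) {x : EuclideanSpace ℝ (Fin n)}
    {D : Set (EuclideanSpace ℝ (Fin n))} (hD : MeasurableSet D) {k v B r h : ℝ}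
    (hk : 0 < k) (hv : 0 < v) (hB : 0 < B) (hr : 0 < r) (hh : 0 < h)
    (hDx : D ⊆ Metric.closedBall x (k * r)) (hvol : volume D = ENNReal.ofReal (v * r ^ n))
    (hw : ∀ t ∈ Ioc (0 : ℝ) 1,
      ∫⁻ w in D, ENNReal.ofReal (|lastCoord n (x + t • (w - x))| ^ (-((p - n) / (p - 1)))) ≤
        ENNReal.ofReal (B * h ^ (-((p - n) / (p - 1)))) * volume D) :
    ∫⁻ w in D, ‖u w - u x‖ₑ ≤
      ENNReal.ofReal (k / (1 - n / p) * B ^ (1 - 1 / p) * v ^ (-(1 / p)) *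
        (r / h) ^ (1 - n / p) * (energy n (p - n) p u).toReal ^ (1 / p)) * volume D := by
  have hn1 : (1 : ℝ) < n := by exact_mod_cast hn
  have hp1 : 1 < p := hn1.trans hnp
  have hp0 : 0 < p := by linarith
  have hθ : 0 < 1 - n / p := by rw [sub_pos, div_lt_one hp0]; exact hnp
  have hpq : p.HolderConjugate (p / (p - 1)) := Real.HolderConjugate.conjExponent hp1
  have hcd := hu.continuous_fderiv one_ne_zero
  have hlm := (continuous_lastCoord n).measurable
  have hE := energy_ne_top (γ := p - n) (by linarith) hp0 hu hc
  set F : EuclideanSpace ℝ (Fin n) → ℝ≥0∞ := (upperHalf n).indicator fun z =>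
    ENNReal.ofReal (‖fderiv ℝ u z‖ ^ p * lastCoord n z ^ (p - n)) ^ (1 / p) with hF
  set η : EuclideanSpace ℝ (Fin n) → ℝ≥0∞ := fun z =>
    ENNReal.ofReal (|lastCoord n z| ^ (-((p - n) / p))) with hη
  have hFm : Measurable F :=
    Measurable.indicator (by fun_prop) (measurableSet_upperHalf n)
  have hηm : Measurable η := by fun_prop
  have hFη : ∀ z, ‖fderiv ℝ u z‖ₑ ≤ F z * η z := by
    intro z
    by_cases hz : z ∈ upperHalf n
    · have hz' : 0 < lastCoord n z := hz
      rw [hF, hη, indicator_of_mem hz, ENNReal.ofReal_rpow_of_nonneg (by positivity)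
        (by positivity), ← ENNReal.ofReal_mul (by positivity), ← ofReal_norm]
      refine ENNReal.ofReal_le_ofReal (le_of_eq ?_)
      rw [abs_of_pos hz', mul_rpow (by positivity) (by positivity), ← rpow_mul (norm_nonneg _),
        ← rpow_mul hz'.le, mul_assoc, ← rpow_add hz', mul_one_div_cancel hp0.ne', mul_one_div,
        add_neg_cancel, rpow_one, rpow_zero, mul_one]
    · have : fderiv ℝ u z = 0 := by
        by_contra h0
        exact hz (hsupp (support_fderiv_subset ℝ h0))
      rw [← ofReal_norm, this, norm_zero, ENNReal.ofReal_zero]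
      exact zero_le
  have hFp : ∫⁻ z, F z ^ p = energy n (p - n) p u := by
    rw [energy, ← lintegral_indicator (measurableSet_upperHalf n)]
    refine lintegral_congr fun z => ?_
    by_cases hz : z ∈ upperHalf n
    · rw [hF, indicator_of_mem hz, indicator_of_mem hz, ← ENNReal.rpow_mul,
        one_div_mul_cancel hp0.ne', ENNReal.rpow_one]
    · rw [hF, indicator_of_notMem hz, indicator_of_notMem hz, ENNReal.zero_rpow_of_pos hp0]
  have hK : ∀ t ∈ Ioc (0 : ℝ) 1, ∫⁻ w in D, η (x + t • (w - x)) ^ (p / (p - 1)) ≤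
      ENNReal.ofReal (B * h ^ (-((p - n) / (p - 1)))) * volume D := by
    intro t ht
    refine le_trans (le_of_eq (lintegral_congr fun w => ?_)) (hw t ht)
    have : 0 < p - 1 := by linarith
    rw [hη, ENNReal.ofReal_rpow_of_nonneg (by positivity) (by positivity),
      ← rpow_mul (abs_nonneg _)]
    congr 2
    field_simp
  have hmain := setLIntegral_enorm_sub_le volume hu hpq (by simpa using hnp) hFm hηm hFη hD hDx hK
  refine hmain.trans (le_of_eq ?_)
  have hq : 1 / (p / (p - 1)) = 1 - 1 / p := by
    have : p - 1 ≠ 0 := by linarith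
    field_simp
  have hq0 : 0 ≤ 1 - 1 / p := by rw [sub_nonneg, div_le_one hp0]; exact hp1.le
  rw [hFp, hvol, hq, finrank_euclideanSpace_fin, ← ENNReal.ofReal_mul (by positivity),
    ← ENNReal.ofReal_mul (p := B * _) (by positivity), ENNReal.ofReal_rpow_of_nonneg (by positivity) hq0, ← ENNReal.ofReal_mul (by positivity),
    ← ENNReal.ofReal_toReal hE, ENNReal.ofReal_rpow_of_nonneg (by positivity) (by positivity),
    ENNReal.toReal_ofReal (by positivity),
    ← ENNReal.ofReal_mul (by positivity),
    ← ENNReal.ofReal_mul (by positivity)]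
  congr 1
  have e1 : (B * h ^ (-((p - n) / (p - 1))) * (v * r ^ n)) ^ (1 - 1 / p) =
      B ^ (1 - 1 / p) * (h ^ (1 - n / p))⁻¹ * (v * v ^ (-(1 / p))) *
        (r ^ n * r ^ (-(n / p))) := by
    rw [mul_rpow (by positivity) (by positivity), mul_rpow (by positivity) (by positivity),
      mul_rpow (by positivity) (by positivity), ← rpow_mul hh.le, ← rpow_neg hh.le,
      ← rpow_natCast r n, ← rpow_mul hr.le, ← rpow_add hr, mul_assoc (B ^ _ * _)]
    have e2 : v * v ^ (-(1 / p)) = v ^ (1 - 1 / p) := by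
      rw [sub_eq_add_neg, rpow_add hv, rpow_one]
    have e3 : -((p - n) / (p - 1)) * (1 - 1 / p) = -(1 - n / p) := by
      have : p - 1 ≠ 0 := by linarith
      field_simp
    rw [e2, e3]
    congr 3
    ring
  rw [e1, div_rpow hr.le hh.le, sub_eq_add_neg 1 ((n : ℝ) / p), rpow_add hr, rpow_one]
  ring

/-- Sup bound from averaging over a box below the boundary, where `u` vanishes. -/
lemma exists_abs_le_energy (n : ℕ) (hn : 2 ≤ n) (p : ℝ) (hnp : (n : ℝ) < p) :
    ∃ M : ℝ, 0 < M ∧ ∀ u : EuclideanSpace ℝ (Fin n) → ℝ,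
      ContDiff ℝ 1 u → HasCompactSupport u → tsupport u ⊆ upperHalf n →
      ∀ x ∈ upperHalf n, |u x| ≤ M * (energy n (p - n) p u).toReal ^ (1 / p) := by
  have hn1 : (1 : ℝ) < n := by exact_mod_cast hn
  have hp1 : 1 < p := hn1.trans hnp
  have hp0 : 0 < p := by linarith
  have hθ : 0 < 1 - n / p := by rw [sub_pos, div_lt_one hp0]; exact hnp
  have ha0 : 0 ≤ (p - n) / (p - 1) := div_nonneg (by linarith) (by linarith)
  have ha1 : (p - n) / (p - 1) < 1 := by rw [div_lt_one (by linarith)]; linarith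
  have hB : 0 < 8 / (1 - (p - n) / (p - 1)) := div_pos (by norm_num) (by linarith)
  refine ⟨2 * n / (1 - n / p) * (8 / (1 - (p - n) / (p - 1))) ^ (1 - 1 / p), by positivity, ?_⟩
  intro u hu hc hsupp x hx
  set h := lastCoord n x with hh
  have hx0 : 0 < h := hx
  let l : Fin n := ⟨n - 1, Nat.sub_lt (by omega) one_pos⟩
  have hlast (z : EuclideanSpace ℝ (Fin n)) : lastCoord n z = z l := by
    simp [lastCoord, l, show 0 < n by omega]
  set I : Fin n → Set ℝ := fun i => if i = l then Icc (-h) 0 else Icc (x i) (x i + h) with hI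
  have hIm : ∀ i, MeasurableSet (I i) := fun i => by simp only [hI]; split_ifs <;> measurability
  have hIv : ∀ i, volume (I i) = ENNReal.ofReal h := fun i => by
    simp only [hI]; split_ifs <;> simp
  set D : Set (EuclideanSpace ℝ (Fin n)) := WithLp.ofLp ⁻¹' Set.univ.pi I with hDdef
  have hpi : MeasurableSet (Set.univ.pi I) := MeasurableSet.univ_pi hIm
  have hmp := PiLp.volume_preserving_ofLp (Fin n)
  have hD : MeasurableSet D := hmp.measurable hpi
  have hvol : volume D = ENNReal.ofReal (1 * h ^ n) := by
    rw [hDdef, hmp.measure_preimage hpi.nullMeasurableSet, volume_pi_pi]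
    simp [hIv, ENNReal.ofReal_pow hx0.le]
  have hDl : ∀ w ∈ D, w l ∈ Icc (-h) 0 := fun w hw => by
    have := hw l (mem_univ _)
    simpa [hI] using this
  have hDx : D ⊆ Metric.closedBall x (2 * n * h) := by
    intro w hw
    rw [mem_closedBall_iff_norm]
    have hcoord : ∀ i, ‖(w - x) i‖ ≤ 2 * h := by
      intro i
      have hi := hw i (mem_univ _)
      rw [PiLp.sub_apply, Real.norm_eq_abs, abs_le]
      simp only [hI] at hi
      split_ifs at hi with hil
      · have hxl : x i = h := by rw [hil, ← hlast]
        constructor <;> linarith [hi.1, hi.2]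
      · constructor <;> linarith [hi.1, hi.2]
    rw [EuclideanSpace.norm_eq]
    refine Real.sqrt_le_iff.2 ⟨by positivity, ?_⟩
    calc ∑ i, ‖(w - x) i‖ ^ 2 ≤ ∑ _i : Fin n, (2 * h) ^ 2 :=
          Finset.sum_le_sum fun i _ => pow_le_pow_left₀ (norm_nonneg _) (hcoord i) 2
      _ = n * (2 * h) ^ 2 := by simp
      _ ≤ (2 * n * h) ^ 2 := by
          nlinarith [mul_nonneg (sq_nonneg h) (by nlinarith : (0 : ℝ) ≤ n * n - n)]
  have hw : ∀ t ∈ Ioc (0 : ℝ) 1,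
      ∫⁻ w in D, ENNReal.ofReal (|lastCoord n (x + t • (w - x))| ^ (-((p - n) / (p - 1)))) ≤
        ENNReal.ofReal (8 / (1 - (p - n) / (p - 1)) * h ^ (-((p - n) / (p - 1)))) * volume D := by
    intro t ht
    simp only [lastCoord_homothety, ← hh]
    simp only [hlast]
    have h1 := hmp.setLIntegral_comp_preimage hpi (f := fun w : Fin n → ℝ =>
      ENNReal.ofReal (|h + t * (w l - h)| ^ (-((p - n) / (p - 1))))) (by fun_prop)
    have h2 := setLIntegral_comp_eval_pi I l (φ := fun s =>
      ENNReal.ofReal (|h + t * (s - h)| ^ (-((p - n) / (p - 1))))) (by fun_prop)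
    have h3 : volume D = (∏ j ∈ Finset.univ.erase l, volume (I j)) * ENNReal.ofReal h := by
      rw [hDdef, hmp.measure_preimage hpi.nullMeasurableSet, volume_pi_pi, ← hIv l,
        Finset.prod_erase_mul _ _ (Finset.mem_univ l)]
    refine (h1.trans h2).trans_le ?_
    rw [h3, mul_left_comm]
    gcongr
    have hIl : I l = Icc (-h) 0 := by simp [hI]
    rw [hIl]
    exact setLIntegral_abs_rpow_neg_le ha0 ha1 hx0 ht
  have hmain := setLIntegral_enorm_sub_le_energy (by omega) hnp hu hc hsupp hD (k := 2 * n) (v := 1)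
    (by positivity) one_pos hB hx0 hx0 hDx hvol hw
  have hzero : ∫⁻ w in D, ‖u w - u x‖ₑ = ENNReal.ofReal |u x| * volume D := by
    rw [← setLIntegral_const]
    refine setLIntegral_congr_fun hD fun w hw => ?_
    have : u w = 0 := by
      refine image_eq_zero_of_notMem_tsupport fun h' => ?_
      have h1 : 0 < lastCoord n w := hsupp h'
      have h2 := (hDl w hw).2
      rw [hlast] at h1
      linarith
    simp [this, ← ofReal_norm]
  rw [hzero] at hmain
  have := le_of_ofReal_mul_le_ofReal_mul (by rw [hvol]; simp; positivity)
    (by rw [hvol]; exact ENNReal.ofReal_ne_top) (by positivity) hmain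
  simpa [div_self hx0.ne'] using this

lemma exists_abs_sub_le_energy (n : ℕ) (hn : 2 ≤ n) (p : ℝ) (hnp : (n : ℝ) < p) :
    ∃ M : ℝ, 0 < M ∧ ∀ u : EuclideanSpace ℝ (Fin n) → ℝ,
      ContDiff ℝ 1 u → HasCompactSupport u → tsupport u ⊆ upperHalf n →
      ∀ x ∈ upperHalf n, ∀ y, ‖x - y‖ ≤ lastCoord n x / 2 →
        |u x - u y| ≤ M * (‖x - y‖ / lastCoord n x) ^ (1 - n / p) *
          (energy n (p - n) p u).toReal ^ (1 / p) := by
  have hn1 : (1 : ℝ) < n := by exact_mod_cast hn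
  have hp1 : 1 < p := hn1.trans hnp
  have hp0 : 0 < p := by linarith
  have hθ : 0 < 1 - n / p := by rw [sub_pos, div_lt_one hp0]; exact hnp
  have ha0 : 0 ≤ (p - n) / (p - 1) := div_nonneg (by linarith) (by linarith)
  have ha1 : (p - n) / (p - 1) < 1 := by rw [div_lt_one (by linarith)]; linarith
  set v : ℝ := (volume (Metric.ball (0 : EuclideanSpace ℝ (Fin n)) 1)).toReal with hv
  have hv0 : 0 < v := ENNReal.toReal_pos (Metric.measure_ball_pos _ _ one_pos).ne'
    measure_ball_lt_top.ne
  refine ⟨2 * (2 / (1 - n / p) * 2 ^ (1 - 1 / p) * v ^ (-(1 / p))), by positivity, ?_⟩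
  intro u hu hc hsupp x hx y hxy
  set h := lastCoord n x with hh
  set r := ‖x - y‖ with hr
  have hx0 : 0 < h := hx
  rcases (norm_nonneg (x - y)).eq_or_lt with h0 | hr0
  · have : x = y := by rw [← sub_eq_zero, ← norm_eq_zero, ← h0]
    rw [this, sub_self, abs_zero]
    positivity
  rw [← hr] at hr0
  have hvol : volume (Metric.closedBall x r) = ENNReal.ofReal (v * r ^ n) := by
    rw [Measure.addHaar_closedBall _ _ hr0.le, finrank_euclideanSpace_fin,
      ENNReal.ofReal_mul hv0.le, hv, ENNReal.ofReal_toReal measure_ball_lt_top.ne, mul_comm]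
  have hpoint : ∀ y ∈ Metric.closedBall x r, ∫⁻ w in Metric.closedBall x r, ‖u w - u y‖ₑ ≤
      ENNReal.ofReal (2 / (1 - n / p) * 2 ^ (1 - 1 / p) * v ^ (-(1 / p)) *
        (r / h) ^ (1 - n / p) * (energy n (p - n) p u).toReal ^ (1 / p)) *
        volume (Metric.closedBall x r) := by
    intro y hy
    refine setLIntegral_enorm_sub_le_energy (by omega) hnp hu hc hsupp
      measurableSet_closedBall two_pos hv0 two_pos hr0 hx0 ?_ hvol ?_
    · refine Metric.closedBall_subset_closedBall' ?_
      rw [dist_comm]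
      linarith [Metric.mem_closedBall.1 hy]
    · intro t ht
      rw [← setLIntegral_const]
      refine setLIntegral_mono' measurableSet_closedBall fun w hw =>
        ENNReal.ofReal_le_ofReal ?_
      have hmem : y + t • (w - y) ∈ Metric.closedBall x r :=
        (convex_closedBall x r).add_smul_sub_mem hy hw ⟨ht.1.le, ht.2⟩
      have h1 := abs_le.1 ((abs_lastCoord_sub_le n _ _).trans (mem_closedBall_iff_norm.1 hmem))
      have hge : h * (1 / 2) ≤ lastCoord n (y + t • (w - y)) := by linarith [h1.1]
      rw [abs_of_pos (by linarith)]
      calc lastCoord n (y + t • (w - y)) ^ (-((p - n) / (p - 1)))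
          ≤ (h * (1 / 2)) ^ (-((p - n) / (p - 1))) :=
            rpow_le_rpow_of_nonpos (by linarith) hge (by linarith)
        _ = (1 / 2 : ℝ) ^ (-((p - n) / (p - 1))) * h ^ (-((p - n) / (p - 1))) := by
            rw [mul_rpow hx0.le (by norm_num)]; ring
        _ ≤ 2 * h ^ (-((p - n) / (p - 1))) := by
            gcongr
            exact one_half_rpow_neg_le ha1.le
  have hsum : ENNReal.ofReal |u x - u y| * volume (Metric.closedBall x r) ≤
      (∫⁻ w in Metric.closedBall x r, ‖u w - u x‖ₑ) +
        ∫⁻ w in Metric.closedBall x r, ‖u w - u y‖ₑ := by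
    have hcu := hu.continuous
    rw [← setLIntegral_const, ← lintegral_add_left (by fun_prop)]
    refine lintegral_mono fun w => ?_
    rw [← Real.norm_eq_abs, ofReal_norm, ← sub_sub_sub_cancel_left _ _ (u w), ← enorm_neg (_ - _),
      neg_sub]
    exact enorm_sub_le
  have hfin := hsum.trans (add_le_add
    (hpoint x (Metric.mem_closedBall_self hr0.le))
    (hpoint y (by rw [mem_closedBall_iff_norm, norm_sub_rev])))
  rw [← add_mul, ← ENNReal.ofReal_add (by positivity) (by positivity)] at hfin
  have hle := le_of_ofReal_mul_le_ofReal_mul (by rw [hvol]; simp; positivity)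
    (by rw [hvol]; exact ENNReal.ofReal_ne_top) (by positivity) hfin
  linarith

lemma half_le_arsinh {s : ℝ} (hs0 : 0 ≤ s) (hs : s ≤ 1) : s / 2 ≤ arsinh s := by
  have h1 : 1 + s ≤ s + √(1 + s ^ 2) := by
    have : (1 : ℝ) ≤ √(1 + s ^ 2) := Real.one_le_sqrt.2 (by nlinarith)
    linarith
  have h2 := Real.one_sub_inv_le_log_of_pos (show 0 < 1 + s by linarith)
  have h3 : s / 2 ≤ 1 - (1 + s)⁻¹ := by
    have : 1 - (1 + s)⁻¹ = s / (1 + s) := by field_simp; ring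
    rw [this]
    gcongr
    linarith
  exact h3.trans (h2.trans (Real.log_le_log (by linarith) h1))

lemma div_three_mul_le_hypDist {n : ℕ} {x y : EuclideanSpace ℝ (Fin n)} (hx : x ∈ upperHalf n)
    (hy : y ∈ upperHalf n) (hxy : ‖x - y‖ ≤ lastCoord n x / 2) :
    ‖x - y‖ / lastCoord n x / 3 ≤ hypDist n x y := by
  have hx0 : 0 < lastCoord n x := hx
  have hy0 : 0 < lastCoord n y := hy
  have h1 := abs_le.1 (abs_lastCoord_sub_le n x y)
  set a := lastCoord n x
  set b := lastCoord n y
  have hle : √(a * b) ≤ 3 / 2 * a := by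
    refine Real.sqrt_le_iff.2 ⟨by positivity, ?_⟩
    nlinarith
  have hge : 1 / 2 * a ≤ √(a * b) := by
    refine Real.le_sqrt_of_sq_le ?_
    nlinarith
  have hpos : 0 < √(a * b) := by positivity
  have hs1 : ‖x - y‖ / (2 * √(a * b)) ≤ 1 := by
    rw [div_le_one (by positivity)]
    linarith
  have h2 := half_le_arsinh (by positivity) hs1
  have h3 : ‖x - y‖ / a / 3 ≤ ‖x - y‖ / (2 * √(a * b)) := by
    rw [div_div]
    exact div_le_div_of_nonneg_left (norm_nonneg _) (by positivity) (by linarith)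
  unfold hypDist
  linarith

lemma one_div_six_le_hypDist {n : ℕ} {x y : EuclideanSpace ℝ (Fin n)} (hx : x ∈ upperHalf n)
    (hy : y ∈ upperHalf n) (hxy : lastCoord n x / 2 < ‖x - y‖) :
    1 / 6 ≤ hypDist n x y := by
  have hx0 : 0 < lastCoord n x := hx
  have hy0 : 0 < lastCoord n y := hy
  have h1 := abs_le.1 (abs_lastCoord_sub_le n x y)
  unfold hypDist
  set a := lastCoord n x
  set b := lastCoord n y
  set r := ‖x - y‖
  have hle : √(a * b) ≤ 3 * r := by
    refine Real.sqrt_le_iff.2 ⟨by linarith, ?_⟩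
    nlinarith
  have h2 : 1 / 6 ≤ r / (2 * √(a * b)) := by
    rw [div_le_div_iff₀ (by norm_num) (by positivity)]
    linarith
  have h3 := half_le_arsinh (s := 1 / 6) (by norm_num) (by norm_num)
  have h4 := Real.arsinh_le_arsinh.2 h2
  linarith

/-- Morrey–Sobolev inequality on the hyperbolic space for compactly supported functions. -/
theorem hyperbolic_morrey_sobolev_compact (n : ℕ) (hn : 2 ≤ n) (p : ℝ) (hnp : (n : ℝ) < p) :
    ∃ C : ℝ, 0 < C ∧
      ∀ u : EuclideanSpace ℝ (Fin n) → ℝ,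
        ContDiff ℝ (⊤ : ℕ∞) u → HasCompactSupport u → tsupport u ⊆ upperHalf n →
        ∀ x ∈ upperHalf n, ∀ y ∈ upperHalf n,
          |u x - u y| ≤
            C * min (hypDist n x y ^ (1 - (n : ℝ) / p)) 1 *
              (energy n (p - n) p u).toReal ^ (1 / p) := by
  obtain ⟨M, hM, hsup⟩ := exists_abs_le_energy n hn p hnp
  obtain ⟨M', hM', hloc⟩ := exists_abs_sub_le_energy n hn p hnp
  have hn1 : (1 : ℝ) < n := by exact_mod_cast hn
  have hp0 : 0 < p := by linarith
  have hθ : 0 < 1 - n / p := by rw [sub_pos, div_lt_one hp0]; exact hnp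
  have hθ1 : 1 - n / p ≤ 1 := sub_le_self _ (by positivity)
  refine ⟨12 * M + 3 * M', by positivity, ?_⟩
  intro u hu hc hsupp x hx y hy
  have hu1 : ContDiff ℝ 1 u := hu.of_le (by exact_mod_cast le_top)
  have hx0 : 0 < lastCoord n x := hx
  have hd0 : 0 ≤ hypDist n x y := by
    rw [hypDist]
    exact mul_nonneg two_pos.le (Real.arsinh_nonneg_iff.2 (by positivity))
  have hmin0 : 0 ≤ min (hypDist n x y ^ (1 - (n : ℝ) / p)) 1 := by positivity
  rcases le_or_gt ‖x - y‖ (lastCoord n x / 2) with hxy | hxy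
  · refine (hloc u hu1 hc hsupp x hx y hxy).trans ?_
    refine mul_le_mul_of_nonneg_right ?_ (by positivity)
    have hd := div_three_mul_le_hypDist hx hy hxy
    set s := ‖x - y‖ / lastCoord n x
    have hs0 : 0 ≤ s := by positivity
    have hs1 : s ≤ 1 := by
      refine (div_le_one hx0).2 ?_
      linarith
    have h3 : s ^ (1 - n / p) ≤ 3 * hypDist n x y ^ (1 - n / p) := by
      calc s ^ (1 - n / p) ≤ (3 * hypDist n x y) ^ (1 - n / p) :=
            rpow_le_rpow hs0 (by linarith) hθ.le
        _ = 3 ^ (1 - n / p) * hypDist n x y ^ (1 - n / p) := mul_rpow (by norm_num) hd0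
        _ ≤ 3 * hypDist n x y ^ (1 - n / p) := by
            gcongr
            exact (rpow_le_rpow_of_exponent_le (by norm_num) hθ1).trans_eq (rpow_one 3)
    have h4 : s ^ (1 - n / p) ≤ 3 * min (hypDist n x y ^ (1 - (n : ℝ) / p)) 1 := by
      rw [mul_min_of_nonneg _ _ (by norm_num)]
      exact le_min h3 ((rpow_le_one hs0 hs1 hθ.le).trans (by norm_num))
    nlinarith
  · have hd := one_div_six_le_hypDist hx hy hxy
    have h6 : 1 / 6 ≤ min (hypDist n x y ^ (1 - (n : ℝ) / p)) 1 := by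
      refine le_min ?_ (by norm_num)
      calc (1 / 6 : ℝ) = (1 / 6) ^ (1 : ℝ) := (rpow_one _).symm
        _ ≤ (1 / 6) ^ (1 - n / p) :=
            rpow_le_rpow_of_exponent_ge (by norm_num) (by norm_num) hθ1
        _ ≤ _ := rpow_le_rpow (by norm_num) hd hθ.le
    have hE0 : 0 ≤ (energy n (p - n) p u).toReal ^ (1 / p) := by positivity
    calc |u x - u y| ≤ |u x| + |u y| := abs_sub _ _
      _ ≤ 2 * M * (energy n (p - n) p u).toReal ^ (1 / p) := by
          linarith [hsup u hu1 hc hsupp x hx, hsup u hu1 hc hsupp y hy]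
      _ ≤ _ := by
          refine mul_le_mul_of_nonneg_right ?_ hE0
          nlinarith
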